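/- (Combinatorial core of Theorem 1, conditional form.) Let n ≥ 3 and let P be an n-dimensional simple polytope in ℝⁿ such that: (i) P has no triangular 2-faces (m₃ = 0); (ii) every vertex of P is contained in at most n+6 quadrilateral 2-faces; and (iii) α₂^{(1)} < 4(n−1+ε)/(n−2+ε). Then n ≤ 8. -/

import Mathlib

open scoped BigOperators

noncomputable section

/-- `E n` is Euclidean `n`-space. -/
abbrev E (n : ℕ) := EuclideanSpace ℝ (Fin n)

/-- A polytope is the convex hull of a nonempty finite set of points. -/
def IsPolytope {n : ℕ} (P : Set (E n)) : Prop :=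
  ∃ S : Finset (E n), S.Nonempty ∧ P = convexHull ℝ (S : Set (E n))

/-- A face of `P` is a nonempty proper exposed face of `P`. -/
def IsFace {n : ℕ} (P F : Set (E n)) : Prop :=
  F.Nonempty ∧ F ≠ P ∧ IsExposed ℝ P F

/-- The dimension of a face: the rank of the direction of its affine span. -/
def faceDim {n : ℕ} (F : Set (E n)) : ℕ :=
  Module.finrank ℝ (affineSpan ℝ F).direction

/-- An `i`-face of `P` is a face of dimension `i`. -/
def IsIFace {n : ℕ} (P F : Set (E n)) (i : ℕ) : Prop :=
  IsFace P F ∧ faceDim F = i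

/-- The set of `i`-faces of `P`. -/
def facesOf {n : ℕ} (P : Set (E n)) (i : ℕ) : Set (Set (E n)) :=
  {F | IsIFace P F i}

/-- `P` is an `n`-dimensional simple polytope: it is a polytope affinely spanning `ℝⁿ`
and every `k`-face (`0 ≤ k ≤ n-1`) is contained in exactly `n - k` facets. -/
def IsSimplePolytope (n : ℕ) (P : Set (E n)) : Prop :=
  IsPolytope P ∧ affineSpan ℝ P = ⊤ ∧
    ∀ k : ℕ, k ≤ n - 1 → ∀ F : Set (E n), IsIFace P F k →
      {G : Set (E n) | IsIFace P G (n - 1) ∧ G ⊇ F}.ncard = n - k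

/-- `α i`: the number of `i`-faces of `P`. -/
def nFaces {n : ℕ} (P : Set (E n)) (i : ℕ) : ℕ :=
  (facesOf P i).ncard

/-- `αᵢ^f`: the number of `i`-faces of `P` contained in the face `f`. -/
def nFacesIn {n : ℕ} (P f : Set (E n)) (i : ℕ) : ℕ :=
  {G : Set (E n) | IsIFace P G i ∧ G ⊆ f}.ncard

/-- `α_k^{(i)}`: the average number of `i`-faces of a `k`-face of `P`. -/
def avgFaces {n : ℕ} (P : Set (E n)) (k i : ℕ) : ℝ :=
  (1 / (nFaces P k : ℝ)) * ∑ᶠ f ∈ facesOf P k, (nFacesIn P f i : ℝ)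

/-- `m i`: the number of 2-faces of `P` containing exactly `i` vertices of `P`. -/
def m2Faces {n : ℕ} (P : Set (E n)) (i : ℕ) : ℕ :=
  {F : Set (E n) | IsIFace P F 2 ∧ nFacesIn P F 0 = i}.ncard

end

open Set Filter Topology

lemma IsPolytope.isCompact' {n : ℕ} {P : Set (E n)} (h : IsPolytope P) : IsCompact P := by
  obtain ⟨S, -, rfl⟩ := h
  exact S.finite_toSet.isCompact_convexHull ℝ

lemma IsPolytope.convex' {n : ℕ} {P : Set (E n)} (h : IsPolytope P) : Convex ℝ P := by
  obtain ⟨S, -, rfl⟩ := h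
  exact convex_convexHull _ _

lemma IsPolytope.finite_extreme {n : ℕ} {P : Set (E n)} (h : IsPolytope P) :
    (P.extremePoints ℝ).Finite := by
  obtain ⟨S, -, rfl⟩ := h
  exact S.finite_toSet.subset extremePoints_convexHull_subset

lemma face_hull {n : ℕ} {P F : Set (E n)} (h : IsPolytope P) (hF : IsExposed ℝ P F) :
    convexHull ℝ (F.extremePoints ℝ) = F := by
  have h1 := closure_convexHull_extremePoints (hF.isCompact h.isCompact') (hF.convex h.convex')
  have h2 : (F.extremePoints ℝ).Finite :=
    h.finite_extreme.subset hF.isExtreme.extremePoints_subset_extremePoints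
  rwa [(h2.isClosed_convexHull ℝ).closure_eq] at h1

lemma finite_faces {n : ℕ} {P : Set (E n)} (h : IsPolytope P) : {F | IsFace P F}.Finite := by
  refine Set.Finite.of_finite_image (f := fun F => F.extremePoints ℝ) ?_ ?_
  · refine h.finite_extreme.finite_subsets.subset ?_
    rintro _ ⟨F, hF, rfl⟩
    exact hF.2.2.isExtreme.extremePoints_subset_extremePoints
  · intro F hF G hG hFG
    have hFG : F.extremePoints ℝ = G.extremePoints ℝ := hFG
    rw [← face_hull h hF.2.2, hFG, face_hull h hG.2.2]

lemma exposed_of_extreme {n : ℕ} {P : Set (E n)} (h : IsPolytope P) {v : E n}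
    (hv : v ∈ P.extremePoints ℝ) : IsExposed ℝ P {v} := by
  intro _
  obtain ⟨S, -, rfl⟩ := h
  have hfin : ((S : Set (E n)) \ {v}).Finite := S.finite_toSet.subset sdiff_subset
  have hnot : v ∉ convexHull ℝ ((S : Set (E n)) \ {v}) := by
    intro hc
    have := inter_extremePoints_subset_extremePoints_of_subset (𝕜 := ℝ)
      (convexHull_mono (𝕜 := ℝ) (sdiff_subset : (S : Set (E n)) \ {v} ⊆ S)) ⟨hc, hv⟩
    exact (extremePoints_convexHull_subset this).2 rfl
  obtain ⟨l, u, h1, h2⟩ := geometric_hahn_banach_closed_point (convex_convexHull ℝ _)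
    (hfin.isClosed_convexHull ℝ) hnot
  have hvS : v ∈ S := extremePoints_convexHull_subset hv
  have key : ∀ y ∈ convexHull ℝ (S : Set (E n)), y = v ∨ l y < l v := by
    intro y hy
    have hc : Convex ℝ ({y | l y < l v} ∪ {v}) := by
      intro a ha b hb s t hs ht hst
      have hs' : s = 1 - t := by linarith
      rcases ha with ha | ha <;> rcases hb with hb | hb
      · left
        simp only [mem_ofPred_eq, map_add, map_smul, smul_eq_mul] at *
        subst hs'
        rcases eq_or_lt_of_le ht with rfl | ht'
        · simpa using ha
        · nlinarith
      · rcases eq_or_lt_of_le hs with rfl | hs''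
        · right
          have : t = 1 := by linarith
          subst this
          simp only [mem_singleton_iff] at *
          simp [hb]
        · left
          simp only [mem_ofPred_eq, map_add, map_smul, smul_eq_mul, mem_singleton_iff] at *
          subst hb
          have ht : t = 1 - s := by linarith
          subst ht
          nlinarith
      · rcases eq_or_lt_of_le ht with rfl | hs''
        · right
          have : s = 1 := by linarith
          subst this
          simp only [mem_singleton_iff] at *
          simp [ha]
        · left
          simp only [mem_ofPred_eq, map_add, map_smul, smul_eq_mul, mem_singleton_iff] at *
          subst ha
          subst hs'
          nlinarith
      · right
        simp only [mem_singleton_iff] at *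
        subst ha
        subst hb
        rw [← add_smul, hst, one_smul]
    have hsub : (S : Set (E n)) ⊆ {y | l y < l v} ∪ {v} := by
      intro z hz
      by_cases hzv : z = v
      · right; exact hzv
      · left
        exact (h1 z (subset_convexHull ℝ _ ⟨hz, hzv⟩)).trans h2
    rcases convexHull_min hsub hc hy with h | h
    · exact Or.inr h
    · exact Or.inl h
  refine ⟨l, ?_⟩
  ext y
  constructor
  · rintro rfl
    refine ⟨hv.1, fun z hz => ?_⟩
    rcases key z hz with rfl | h
    · exact le_rfl
    · exact h.le
  · rintro ⟨hy, hy2⟩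
    rcases key y hy with rfl | h
    · rfl
    · exact absurd (hy2 v hv.1) (not_le.2 h)

lemma vertex_iff {n : ℕ} (hn : 3 ≤ n) {P : Set (E n)} (h : IsPolytope P)
    (hs : affineSpan ℝ P = ⊤) (V : Set (E n)) :
    IsIFace P V 0 ↔ ∃ v ∈ P.extremePoints ℝ, V = {v} := by
  constructor
  · rintro ⟨⟨⟨v, hv⟩, -, hE⟩, hd⟩
    have : V = {v} := by
      rw [faceDim, Submodule.finrank_eq_zero, direction_affineSpan] at hd
      have hss := (vectorSpan_eq_bot_iff_subsingleton ℝ).1 hd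
      exact hss.eq_singleton_of_mem hv
    subst this
    exact ⟨v, isExtreme_singleton.1 hE.isExtreme, rfl⟩
  · rintro ⟨v, hv, rfl⟩
    refine ⟨⟨singleton_nonempty _, ?_, exposed_of_extreme h hv⟩, ?_⟩
    · rintro rfl
      have : Module.finrank ℝ (affineSpan ℝ {v}).direction = n := by
        rw [hs, AffineSubspace.direction_top, finrank_top, finrank_euclideanSpace_fin]
      rw [direction_affineSpan, vectorSpan_singleton, finrank_bot] at this
      omega
    · rw [faceDim, direction_affineSpan, vectorSpan_singleton, finrank_bot]

lemma face_span_ne_top {n : ℕ} {P F : Set (E n)} (hF : IsFace P F) : faceDim F < n := by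
  by_contra hlt
  have h1 : (affineSpan ℝ F).direction = ⊤ := by
    apply Submodule.eq_top_of_finrank_eq
    apply le_antisymm (Submodule.finrank_le _)
    simpa [faceDim] using hlt
  have h2 : affineSpan ℝ F = ⊤ :=
    (AffineSubspace.direction_eq_top_iff_of_nonempty ((affineSpan_nonempty ℝ).2 hF.1)).1 h1
  obtain ⟨⟨w, hw⟩, hne, hE⟩ := hF
  obtain ⟨l, hl⟩ := hE ⟨w, hw⟩
  have hw' := hl ▸ hw
  have h3 : ∀ x : E n, l x = l w := by
    intro x
    have hx : x ∈ affineSpan ℝ F := by rw [h2]; trivial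
    refine affineSpan_induction (p := fun x => l x = l w) hx ?_ ?_
    · intro y hy
      rw [hl] at hy
      exact le_antisymm (hw'.2 y hy.1) (hy.2 w hw'.1)
    · intro c u v w hu hv hw
      simp [hu, hv, hw]
  apply hne
  rw [hl]
  ext x
  simp [h3]

lemma hrep {n : ℕ} {P : Set (E n)} (h : IsPolytope P) (hs : affineSpan ℝ P = ⊤)
    (L : Set (E n) → StrongDual ℝ (E n))
    (hL : ∀ F, IsFace P F → F = {x ∈ P | ∀ y ∈ P, L F y ≤ L F x}) (x : E n)
    (hx : ∀ F, IsIFace P F (n-1) → ∀ g ∈ F, L F x ≤ L F g) : x ∈ P := by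
  by_contra hxP
  have hint : (interior P).Nonempty := h.convex'.interior_nonempty_iff_affineSpan_eq_top.2 hs
  have hfin : {F | IsFace P F ∧ faceDim F + 2 ≤ n}.Finite :=
    (finite_faces h).subset fun F hF => hF.1
  obtain ⟨p, hp, hp2⟩ : ∃ p ∈ interior P, ∀ F, IsFace P F ∧ faceDim F + 2 ≤ n →
      p ∉ affineSpan ℝ (insert x F) := by
    by_contra! hcon
    have hsub : interior P ⊆ ⋃ F ∈ {F | IsFace P F ∧ faceDim F + 2 ≤ n},
        (affineSpan ℝ (insert x F) : Set (E n)) := by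
      intro p hp
      obtain ⟨F, hF, hpF⟩ := hcon p hp
      exact mem_biUnion hF hpF
    have h0 : MeasureTheory.volume (⋃ F ∈ {F | IsFace P F ∧ faceDim F + 2 ≤ n},
        (affineSpan ℝ (insert x F) : Set (E n))) = 0 := by
      rw [MeasureTheory.measure_biUnion_null_iff hfin.countable]
      intro F hF
      apply MeasureTheory.Measure.addHaar_affineSubspace
      intro htop
      have h1 : Module.finrank ℝ (affineSpan ℝ (insert x F)).direction = n := by
        rw [htop, AffineSubspace.direction_top, finrank_top, finrank_euclideanSpace_fin]
      have h2 := finrank_vectorSpan_insert_le_set ℝ F x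
      rw [direction_affineSpan] at h1
      have h3 := hF.2
      rw [faceDim, direction_affineSpan] at h3
      omega
    exact (isOpen_interior.measure_pos MeasureTheory.volume hint).ne'
      (MeasureTheory.measure_mono_null hsub h0)
  obtain ⟨q, hq, hqf⟩ : ((segment ℝ p x) ∩ frontier P).Nonempty := by
    by_contra hemp
    obtain ⟨z, -, hz1, hz2⟩ := (convex_segment p x).isPreconnected (interior P) Pᶜ isOpen_interior
      h.isCompact'.isClosed.isOpen_compl (by
        intro z hz
        by_cases hzP : z ∈ P
        · left
          by_contra hzi
          exact hemp ⟨z, hz, subset_closure hzP, hzi⟩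
        · right; exact hzP)
      ⟨p, left_mem_segment _ _ _, hp⟩ ⟨x, right_mem_segment _ _ _, hxP⟩
    exact hz2 (interior_subset hz1)
  have hqP : q ∈ P := h.isCompact'.isClosed.frontier_subset hqf
  obtain ⟨l, hl⟩ := geometric_hahn_banach_open_point h.convex'.interior isOpen_interior hqf.2
  have hl2 : ∀ y ∈ P, l y ≤ l q := by
    intro y hy
    have : P ⊆ closure (interior P) := by
      rw [h.convex'.closure_interior_eq_closure_of_nonempty_interior hint]
      exact subset_closure
    have hcl : closure (interior P) ⊆ {y | l y ≤ l q} :=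
      closure_minimal (fun a ha => (hl a ha).le) (isClosed_le l.continuous continuous_const)
    exact hcl (this hy)
  set F := {x ∈ P | ∀ y ∈ P, l y ≤ l x} with hFdef
  have hqF : q ∈ F := ⟨hqP, hl2⟩
  have hpF : p ∉ F := fun hc => absurd (hc.2 q hqP) (not_le.2 (hl p hp))
  have hF : IsFace P F := ⟨⟨q, hqF⟩, fun hc => hpF (hc ▸ interior_subset hp), fun _ => ⟨l, rfl⟩⟩
  have hdim := face_span_ne_top hF
  obtain ⟨a, b, ha, hb, hab, rfl⟩ := hq
  have hbpos : 0 < b := by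
    rcases eq_or_lt_of_le hb with rfl | hb
    · have : a = 1 := by linarith
      subst this
      exfalso
      simp at hqF
      exact hpF hqF
    · exact hb
  have hapos : 0 < a := by
    rcases eq_or_lt_of_le ha with rfl | hb
    · have : b = 1 := by linarith
      subst this
      exfalso
      simp at hqP
      exact hxP hqP
    · exact hb
  by_cases hd : faceDim F = n - 1
  · have h1 := hx F ⟨hF, hd⟩ _ hqF
    have h2 : L F p < L F (a • p + b • x) := by
      by_contra! hcon
      apply hpF
      rw [hL F hF] at hqF ⊢
      exact ⟨interior_subset hp, fun y hy => (hqF.2 y hy).trans hcon⟩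
    simp only [map_add, map_smul, smul_eq_mul] at h1 h2
    have : a = 1 - b := by linarith
    subst this
    nlinarith
  · refine hp2 F ⟨hF, by omega⟩ ?_
    have hxs : x ∈ affineSpan ℝ (insert x F) := subset_affineSpan ℝ _ (mem_insert _ _)
    have hqs : a • p + b • x ∈ affineSpan ℝ (insert x F) :=
      subset_affineSpan ℝ _ (mem_insert_of_mem _ hqF)
    have := AffineMap.lineMap_mem (1/a) hxs hqs
    convert this using 1
    rw [AffineMap.lineMap_apply_module]
    have hb' : b = 1 - a := by linarith
    subst hb'
    rw [smul_add, smul_smul, smul_smul, one_div, inv_mul_cancel₀ hapos.ne', one_smul,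
      add_left_comm, ← add_smul]
    have : 1 - a⁻¹ + a⁻¹ * (1 - a) = 0 := by field_simp; ring
    rw [this]; simp

lemma local_cone {n : ℕ} (hn : 3 ≤ n) {P : Set (E n)} (hP : IsSimplePolytope n P) {v : E n}
    (hv : v ∈ P.extremePoints ℝ) :
    ∃ (b : Module.Basis (Fin n) ℝ (E n)) (t : Fin n → ℝ), (∀ j, 0 < t j) ∧
      (∀ j, v + t j • b j ∈ P) ∧ ∀ x ∈ P, ∀ j, 0 ≤ b.repr (x - v) j := by
  obtain ⟨h, hs, hsimple⟩ := hP
  have hL : ∀ F, ∃ l : StrongDual ℝ (E n), IsFace P F → F = {x ∈ P | ∀ y ∈ P, l y ≤ l x} := by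
    intro F
    by_cases hF : IsFace P F
    · obtain ⟨l, hl⟩ := hF.2.2 hF.1
      exact ⟨l, fun _ => hl⟩
    · exact ⟨0, fun h => absurd h hF⟩
  choose L hL using hL
  have hcard := hsimple 0 (by omega) {v} ((vertex_iff hn h hs _).2 ⟨v, hv, rfl⟩)
  rw [Nat.sub_zero, ← Nat.card_coe_set_eq] at hcard
  have : Finite {G : Set (E n) | IsIFace P G (n - 1) ∧ G ⊇ {v}} :=
    Nat.finite_of_card_ne_zero (by omega)
  let g := (Finite.equivFinOfCardEq hcard).symm
  have hg : ∀ i, IsIFace P (g i : Set (E n)) (n-1) ∧ v ∈ (g i : Set (E n)) := fun i =>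
    ⟨(g i).2.1, (g i).2.2 rfl⟩
  have hmove : ∀ u : E n, (∀ i, L (g i) u ≤ 0) → ∃ t : ℝ, 0 < t ∧ v + t • u ∈ P := by
    intro u hu
    have hfin : {F | IsIFace P F (n-1)}.Finite := (finite_faces h).subset fun F hF => hF.1
    have hev : ∀ᶠ t : ℝ in 𝓝[>] 0, ∀ F ∈ {F | IsIFace P F (n-1)}, ∀ z ∈ F,
        L F (v + t • u) ≤ L F z := by
      rw [eventually_all_finite hfin]
      intro F hF
      have hLF := hL F hF.1
      by_cases hvF : v ∈ F
      · have : L F u ≤ 0 := by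
          have := hu (g.symm ⟨F, hF, by simpa using hvF⟩)
          simpa using this
        filter_upwards [self_mem_nhdsWithin] with t ht z hz
        have ht : 0 < t := ht
        rw [hLF] at hz
        have := hz.2 v hv.1
        simp only [map_add, map_smul, smul_eq_mul]
        nlinarith
      · obtain ⟨w, hw⟩ := hF.1.1
        have hlt : L F v < L F w := by
          by_contra! hcon
          apply hvF
          rw [hLF] at hw ⊢
          exact ⟨hv.1, fun y hy => (hw.2 y hy).trans hcon⟩
        have hcont : Continuous fun t : ℝ => L F (v + t • u) := by fun_prop
        have h1 : ∀ᶠ t : ℝ in 𝓝 0, L F (v + t • u) < L F w :=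
          hcont.continuousAt.eventually_lt continuousAt_const (by simpa using hlt)
        filter_upwards [nhdsWithin_le_nhds h1] with t ht z hz
        rw [hLF] at hz hw
        exact ht.le.trans (hz.2 w hw.1)
    obtain ⟨t, ht, ht2⟩ := (hev.and self_mem_nhdsWithin).exists
    exact ⟨t, ht2, hrep h hs L hL _ ht⟩
  let A : E n →ₗ[ℝ] (Fin n → ℝ) := LinearMap.pi fun i => -(L (g i)).toLinearMap
  have hA : ∀ x i, A x i = - L (g i) x := fun x i => rfl
  have hinj : Function.Injective A := by
    rw [← LinearMap.ker_eq_bot, LinearMap.ker_eq_bot']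
    intro u hu
    have h0 : ∀ i, L (g i) u = 0 := by
      intro i
      have := congrFun hu i
      rw [hA] at this
      simpa using this
    obtain ⟨t1, ht1, h1⟩ := hmove u fun i => (h0 i).le
    obtain ⟨t2, ht2, h2⟩ := hmove (-u) fun i => by simp [h0 i]
    have := hv.2 h1 h2 ⟨t2 / (t1 + t2), t1 / (t1 + t2), by positivity, by positivity, by
      field_simp; ring, by
      simp only [smul_add, smul_neg, smul_smul]
      rw [add_add_add_comm, ← add_smul, ← sub_eq_add_neg, ← sub_smul]
      have e1 : t2 / (t1 + t2) + t1 / (t1 + t2) = 1 := by field_simp; ring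
      have e2 : t2 / (t1 + t2) * t1 - t1 / (t1 + t2) * t2 = 0 := by field_simp; ring
      rw [e1, e2]; simp⟩
    simpa [ht1.ne'] using this
  let e := A.linearEquivOfInjective hinj (by simp)
  let b := Module.Basis.ofEquivFun e
  have hb : ∀ x i, b.repr x i = - L (g i) x := by
    intro x i
    rw [Module.Basis.ofEquivFun_repr_apply, LinearMap.linearEquivOfInjective_apply, hA]
  have hbj : ∀ j, ∃ t : ℝ, 0 < t ∧ v + t • b j ∈ P := by
    intro j
    apply hmove
    intro i
    have := hb (b j) i
    rw [Module.Basis.repr_self, Finsupp.single_apply] at this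
    split_ifs at this <;> linarith
  choose t ht ht2 using hbj
  refine ⟨b, t, ht, ht2, fun x hx j => ?_⟩
  rw [hb]
  have h1 := (hg j).2
  rw [hL _ (hg j).1.1] at h1
  have := h1.2 x hx
  simp only [map_sub]
  linarith

/-- The face at `v` spanned by the directions in `J`. -/
def coneFace {n : ℕ} (P : Set (E n)) (v : E n) (b : Module.Basis (Fin n) ℝ (E n))
    (J : Finset (Fin n)) : Set (E n) :=
  {x ∈ P | ∀ j, j ∉ J → b.repr (x - v) j = 0}

section cone
variable {n : ℕ} {P : Set (E n)} {v : E n} {b : Module.Basis (Fin n) ℝ (E n)} {t : Fin n → ℝ}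

lemma mem_coneFace_v (hv : v ∈ P) (J : Finset (Fin n)) : v ∈ coneFace P v b J :=
  ⟨hv, by simp⟩

lemma mem_coneFace_iff (ht : ∀ j, 0 < t j) (hP : ∀ j, v + t j • b j ∈ P)
    (J : Finset (Fin n)) (j : Fin n) : v + t j • b j ∈ coneFace P v b J ↔ j ∈ J := by
  constructor
  · rintro ⟨-, h⟩
    by_contra hj
    have := h j hj
    simp [(ht j).ne'] at this
  · intro hj
    refine ⟨hP j, fun i hi => ?_⟩
    have : j ≠ i := fun h => hi (h ▸ hj)
    simp [this]

lemma coneFace_dim (hv : v ∈ P) (ht : ∀ j, 0 < t j) (hP : ∀ j, v + t j • b j ∈ P)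
    (J : Finset (Fin n)) : faceDim (coneFace P v b J) = J.card := by
  have hspan : vectorSpan ℝ (coneFace P v b J) = Submodule.span ℝ (b '' (J : Set (Fin n))) := by
    rw [vectorSpan_eq_span_vsub_set_right ℝ (mem_coneFace_v (b := b) hv J)]
    apply le_antisymm
    · rw [Submodule.span_le]
      rintro _ ⟨x, hx, rfl⟩
      simp only [SetLike.mem_coe]
      rw [Module.Basis.mem_span_image]
      intro j hj
      by_contra hjJ
      have := hx.2 j hjJ
      simp only [vsub_eq_sub, Finset.mem_coe, Finsupp.mem_support_iff] at hj
      exact hj this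
    · rw [Submodule.span_le]
      rintro _ ⟨j, hj, rfl⟩
      have h1 : t j • b j ∈ Submodule.span ℝ ((fun x => x -ᵥ v) '' coneFace P v b J) :=
        Submodule.subset_span ⟨_, (mem_coneFace_iff ht hP J j).2 hj, by simp⟩
      have := Submodule.smul_mem _ (t j)⁻¹ h1
      rwa [smul_smul, inv_mul_cancel₀ (ht j).ne', one_smul] at this
  rw [faceDim, direction_affineSpan, hspan]
  have hli : LinearIndependent ℝ (fun j : J => b j) :=
    b.linearIndependent.comp _ Subtype.val_injective
  have := finrank_span_eq_card hli
  rw [Fintype.card_coe] at this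
  have himg : b '' (J : Set (Fin n)) = Set.range (fun j : J => b j) := by
    ext x
    simp
  rw [himg, this]

lemma coneFace_isFace (hv : v ∈ P) (ht : ∀ j, 0 < t j) (hP : ∀ j, v + t j • b j ∈ P)
    (hpos : ∀ x ∈ P, ∀ j, 0 ≤ b.repr (x - v) j)
    (J : Finset (Fin n)) (hJ : J.card < n) : IsIFace P (coneFace P v b J) J.card := by
  refine ⟨⟨⟨v, mem_coneFace_v hv J⟩, ?_, ?_⟩, coneFace_dim hv ht hP J⟩
  · intro h
    obtain ⟨j, hj⟩ : ∃ j, j ∉ J := by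
      by_contra! hcon
      have : J = Finset.univ := Finset.eq_univ_iff_forall.2 hcon
      subst this
      simp at hJ
    exact hj ((mem_coneFace_iff ht hP J j).1 (by rw [h]; exact hP j))
  · intro _
    let l0 : E n →ₗ[ℝ] ℝ := - ∑ j ∈ Jᶜ, b.coord j
    have hl0 : ∀ x, l0 x = - ∑ j ∈ Jᶜ, b.repr x j := by
      intro x; simp [l0]
    refine ⟨LinearMap.toContinuousLinearMap l0, ?_⟩
    simp only [LinearMap.coe_toContinuousLinearMap']
    have hsub : ∀ x, l0 x = l0 v - ∑ j ∈ Jᶜ, b.repr (x - v) j := by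
      intro x
      have := hl0 (x - v)
      rw [map_sub] at this
      linarith
    ext x
    constructor
    · rintro ⟨hx, hx2⟩
      refine ⟨hx, fun y hy => ?_⟩
      rw [hsub x, hsub y]
      have e1 : ∑ j ∈ Jᶜ, b.repr (x - v) j = 0 :=
        Finset.sum_eq_zero fun j hj => hx2 j (Finset.mem_compl.1 hj)
      have e2 : 0 ≤ ∑ j ∈ Jᶜ, b.repr (y - v) j :=
        Finset.sum_nonneg fun j hj => hpos y hy j
      linarith
    · rintro ⟨hx, hx2⟩
      refine ⟨hx, fun j hj => ?_⟩
      have h1 := hx2 v hv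
      rw [hsub x] at h1
      have e2 : 0 ≤ ∑ j ∈ Jᶜ, b.repr (x - v) j :=
        Finset.sum_nonneg fun j hj => hpos x hx j
      have e3 : ∑ j ∈ Jᶜ, b.repr (x - v) j = 0 := by linarith
      exact (Finset.sum_eq_zero_iff_of_nonneg fun j hj => hpos x hx j).1 e3 j
        (Finset.mem_compl.2 hj)

lemma coneFace_injective (ht : ∀ j, 0 < t j) (hP : ∀ j, v + t j • b j ∈ P) :
    Function.Injective (coneFace P v b) := by
  intro J K h
  ext j
  rw [← mem_coneFace_iff ht hP J j, h, mem_coneFace_iff ht hP K j]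

lemma coneFace_mono {J K : Finset (Fin n)} (h : J ⊆ K) : coneFace P v b J ⊆ coneFace P v b K :=
  fun _ hx => ⟨hx.1, fun j hj => hx.2 j fun hc => hj (h hc)⟩

lemma face_eq_coneFace (hP : ∀ j, v + t j • b j ∈ P) (ht : ∀ j, 0 < t j)
    (hpos : ∀ x ∈ P, ∀ j, 0 ≤ b.repr (x - v) j)
    {F : Set (E n)} (hF : IsFace P F) (hvF : v ∈ F) : ∃ J, F = coneFace P v b J := by
  classical
  obtain ⟨l, hl⟩ := hF.2.2 hF.1
  rw [hl] at hvF
  have hneg : ∀ j, l (b j) ≤ 0 := by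
    intro j
    have h1 := hvF.2 _ (hP j)
    have h2 := ht j
    simp only [map_add, map_smul, smul_eq_mul] at h1
    nlinarith
  have hexp : ∀ x, l x = l v + ∑ j, b.repr (x - v) j * l (b j) := by
    intro x
    have := congrArg l (b.sum_repr (x - v))
    simp only [map_sum, map_smul, smul_eq_mul, map_sub l] at this
    linarith
  have hterm : ∀ x ∈ P, ∀ j ∈ Finset.univ, b.repr (x - v) j * l (b j) ≤ 0 := fun x hx j _ =>
    mul_nonpos_of_nonneg_of_nonpos (hpos x hx j) (hneg j)
  refine ⟨Finset.univ.filter fun j => l (b j) = 0, ?_⟩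
  rw [hl]
  ext x
  constructor
  · rintro ⟨hx, hx2⟩
    refine ⟨hx, fun j hj => ?_⟩
    have h1 := hx2 v hvF.1
    rw [hexp x] at h1
    have h2 := Finset.sum_nonpos (hterm x hx)
    have h3 : ∑ j, b.repr (x - v) j * l (b j) = 0 := by linarith
    have h4 := (Finset.sum_eq_zero_iff_of_nonpos (hterm x hx)).1 h3 j (Finset.mem_univ _)
    rcases mul_eq_zero.1 h4 with h | h
    · exact h
    · exact absurd (by simpa using h) hj
  · rintro ⟨hx, hx2⟩
    refine ⟨hx, fun y hy => ?_⟩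
    have : l x = l v := by
      rw [hexp x, Finset.sum_eq_zero, add_zero]
      intro j _
      by_cases hj : l (b j) = 0
      · simp [hj]
      · rw [hx2 j (by simpa using hj), zero_mul]
    rw [this]
    exact hvF.2 y hy

end cone

lemma vertices_eq {n : ℕ} (hn : 3 ≤ n) {P : Set (E n)} (h : IsPolytope P)
    (hs : affineSpan ℝ P = ⊤) {f : Set (E n)} (hf : IsFace P f) :
    {G : Set (E n) | IsIFace P G 0 ∧ G ⊆ f} = singleton '' f.extremePoints ℝ := by
  ext G
  simp only [mem_ofPred_eq, mem_image, vertex_iff hn h hs]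
  have hE : f.extremePoints ℝ = f ∩ P.extremePoints ℝ := hf.2.2.isExtreme.extremePoints_eq
  rw [hE]
  constructor
  · rintro ⟨⟨v, hv, rfl⟩, hvf⟩
    exact ⟨v, ⟨hvf rfl, hv⟩, rfl⟩
  · rintro ⟨v, ⟨hvf, hv⟩, rfl⟩
    exact ⟨⟨v, hv, rfl⟩, by simpa using hvf⟩

lemma nVert_eq {n : ℕ} (hn : 3 ≤ n) {P : Set (E n)} (h : IsPolytope P)
    (hs : affineSpan ℝ P = ⊤) {f : Set (E n)} (hf : IsFace P f) :
    nFacesIn P f 0 = (f.extremePoints ℝ).ncard := by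
  rw [nFacesIn, vertices_eq hn h hs hf, ncard_image_of_injective _ singleton_injective]

lemma three_le {n : ℕ} (hn : 3 ≤ n) {P : Set (E n)} (h : IsPolytope P)
    (hs : affineSpan ℝ P = ⊤) {f : Set (E n)} (hf : IsIFace P f 2) : 3 ≤ nFacesIn P f 0 := by
  classical
  rw [nVert_eq hn h hs hf.1]
  have hfin : (f.extremePoints ℝ).Finite :=
    h.finite_extreme.subset hf.1.2.2.isExtreme.extremePoints_subset_extremePoints
  have hd := hf.2
  rw [faceDim, ← face_hull h hf.1.2.2, affineSpan_convexHull, direction_affineSpan] at hd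
  rw [ncard_eq_toFinset_card _ hfin]
  by_contra hlt
  rcases Nat.eq_zero_or_pos hfin.toFinset.card with h0 | hpos
  · have : f.extremePoints ℝ = ∅ := by simpa using h0
    rw [this, vectorSpan_empty, finrank_bot] at hd
    omega
  · have := finrank_vectorSpan_image_finset_le ℝ (id : E n → E n) hfin.toFinset
      (n := hfin.toFinset.card - 1) (by omega)
    rw [Finset.image_id, hfin.coe_toFinset] at this
    omega

lemma edge_le_two {n : ℕ} (hn : 3 ≤ n) {P : Set (E n)} (h : IsPolytope P)
    (hs : affineSpan ℝ P = ⊤) {f : Set (E n)} (hf : IsIFace P f 1) : nFacesIn P f 0 ≤ 2 := by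
  rw [nVert_eq hn h hs hf.1]
  have hfin : (f.extremePoints ℝ).Finite :=
    h.finite_extreme.subset hf.1.2.2.isExtreme.extremePoints_subset_extremePoints
  by_contra! hlt
  obtain ⟨a, b, c, ha, hb, hc, hab, hac, hbc⟩ := (two_lt_ncard_iff hfin).1 hlt
  have hcol : Collinear ℝ f := by
    rw [collinear_iff_finrank_le_one, ← direction_affineSpan]
    exact hf.2.le
  have hcol3 : Collinear ℝ {a, b, c} := hcol.subset (by
    rintro x (rfl | rfl | rfl)
    exacts [ha.1, hb.1, hc.1])
  rw [mem_extremePoints_iff_forall_segment] at ha hb hc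
  rcases hcol3.wbtw_or_wbtw_or_wbtw with hw | hw | hw <;> rw [← mem_segment_iff_wbtw] at hw
  · rcases hb.2 a ha.1 c hc.1 hw with h | h
    · exact hab h
    · exact hbc h.symm
  · rcases hc.2 b hb.1 a ha.1 hw with h | h
    · exact hbc h
    · exact hac h
  · rcases ha.2 c hc.1 b hb.1 hw with h | h
    · exact hac h.symm
    · exact hab h.symm

lemma finite_IFaces {n : ℕ} {P : Set (E n)} (h : IsPolytope P) (i : ℕ) (p : Set (E n) → Prop) :
    {F | IsIFace P F i ∧ p F}.Finite := (finite_faces h).subset fun _ hF => hF.1.1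

lemma two_edges {n : ℕ} (hn : 3 ≤ n) {P : Set (E n)} (hP : IsSimplePolytope n P)
    {f V : Set (E n)} (hf : IsIFace P f 2) (hV : IsIFace P V 0) (hVf : V ⊆ f) :
    2 ≤ {e | IsIFace P e 1 ∧ (e ⊆ f ∧ V ⊆ e)}.ncard := by
  classical
  obtain ⟨v, hv, rfl⟩ := (vertex_iff hn hP.1 hP.2.1 V).1 hV
  obtain ⟨b, t, ht, hmem, hpos⟩ := local_cone hn hP hv
  obtain ⟨J, rfl⟩ := face_eq_coneFace hmem ht hpos hf.1 (hVf rfl)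
  have hJ : J.card = 2 := by rw [← coneFace_dim hv.1 ht hmem J]; exact hf.2
  have hsub : ((J.image fun j => coneFace P v b {j} : Finset (Set (E n))) : Set (Set (E n))) ⊆
      {e | IsIFace P e 1 ∧ (e ⊆ coneFace P v b J ∧ {v} ⊆ e)} := by
    intro e he
    simp only [Finset.coe_image, mem_image, Finset.mem_coe] at he
    obtain ⟨j, hj, rfl⟩ := he
    refine ⟨?_, coneFace_mono (by simpa using hj), ?_⟩
    · have := coneFace_isFace hv.1 ht hmem hpos {j} (by simp; omega)
      simpa using this
    · simpa using mem_coneFace_v hv.1 _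
  have := ncard_le_ncard hsub (finite_IFaces hP.1 1 _)
  rw [ncard_coe_finset, Finset.card_image_of_injective, hJ] at this
  · exact this
  · intro i j hij
    simpa using coneFace_injective ht hmem hij

lemma many_faces {n : ℕ} (hn : 3 ≤ n) {P : Set (E n)} (hP : IsSimplePolytope n P)
    {V : Set (E n)} (hV : IsIFace P V 0) :
    n.choose 2 ≤ {f | IsIFace P f 2 ∧ V ⊆ f}.ncard := by
  classical
  obtain ⟨v, hv, rfl⟩ := (vertex_iff hn hP.1 hP.2.1 V).1 hV
  obtain ⟨b, t, ht, hmem, hpos⟩ := local_cone hn hP hv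
  have hsub : (((Finset.powersetCard 2 (Finset.univ : Finset (Fin n))).image
      (coneFace P v b) : Finset (Set (E n))) : Set (Set (E n))) ⊆
      {f | IsIFace P f 2 ∧ {v} ⊆ f} := by
    intro e he
    simp only [Finset.coe_image, mem_image, Finset.mem_coe, Finset.mem_powersetCard] at he
    obtain ⟨J, ⟨-, hJ⟩, rfl⟩ := he
    refine ⟨?_, ?_⟩
    · have := coneFace_isFace hv.1 ht hmem hpos J (by omega)
      rwa [hJ] at this
    · simpa using mem_coneFace_v hv.1 _
  have := ncard_le_ncard hsub (finite_IFaces hP.1 2 _)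
  rwa [ncard_coe_finset, Finset.card_image_of_injective _ (coneFace_injective ht hmem),
    Finset.card_powersetCard, Finset.card_univ, Fintype.card_fin] at this

/-- Finset of `i`-faces. -/
noncomputable def fF {n : ℕ} {P : Set (E n)} (h : IsPolytope P) (i : ℕ) : Finset (Set (E n)) :=
  (finite_IFaces h i (fun _ => True)).toFinset

lemma mem_fF {n : ℕ} {P : Set (E n)} (h : IsPolytope P) (i : ℕ) (F : Set (E n)) :
    F ∈ fF h i ↔ IsIFace P F i := by simp [fF]

lemma ncard_fF {n : ℕ} {P : Set (E n)} (h : IsPolytope P) (i : ℕ) (p : Set (E n) → Prop)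
    [DecidablePred p] :
    {F | IsIFace P F i ∧ p F}.ncard = ((fF h i).filter p).card := by
  rw [← ncard_coe_finset]
  congr 1
  ext F
  simp [mem_fF]

lemma vert_le_edges {n : ℕ} (hn : 3 ≤ n) {P : Set (E n)} (hP : IsSimplePolytope n P)
    {f : Set (E n)} (hf : IsIFace P f 2) : nFacesIn P f 0 ≤ nFacesIn P f 1 := by
  classical
  rw [nFacesIn, nFacesIn, ncard_fF hP.1, ncard_fF hP.1]
  have := Finset.card_mul_le_card_mul (s := (fF hP.1 0).filter (· ⊆ f))
    (t := (fF hP.1 1).filter (· ⊆ f)) (fun V e => V ⊆ e) (m := 2) (n := 2) ?_ ?_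
  · omega
  · intro V hV
    rw [Finset.mem_filter, mem_fF] at hV
    have := two_edges hn hP hf hV.1 hV.2
    rw [ncard_fF hP.1] at this
    rw [Finset.bipartiteAbove, Finset.filter_filter]
    convert this
  · intro e he
    rw [Finset.mem_filter, mem_fF] at he
    have := edge_le_two hn hP.1 hP.2.1 he.1
    rw [nFacesIn, ncard_fF hP.1] at this
    refine (Finset.card_le_card ?_).trans this
    rw [Finset.bipartiteBelow, Finset.filter_filter]
    intro V
    simp only [Finset.mem_filter]
    tauto

/-- **Combinatorial core of Theorem 1 (conditional form).** If an `n`-dimensional simple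
polytope (`n ≥ 3`) has no triangular 2-faces, each of its vertices lies in at most `n+6`
quadrilateral 2-faces, and Nikulin's estimate `α₂^{(1)} < 4(n-1+ε)/(n-2+ε)` holds,
then `n ≤ 8`. -/
theorem dimension_le_eight (n : ℕ) (hn : 3 ≤ n) (P : Set (E n))
    (hP : IsSimplePolytope n P) (ε : ℝ) (hε : ε = if Even n then 0 else 1)
    (h3 : m2Faces P 3 = 0)
    (hquad : ∀ V : Set (E n), IsIFace P V 0 →
      {F : Set (E n) | IsIFace P F 2 ∧ nFacesIn P F 0 = 4 ∧ V ⊆ F}.ncard ≤ n + 6)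
    (hnik : avgFaces P 2 1 < 4 * ((n : ℝ) - 1 + ε) / ((n : ℝ) - 2 + ε)) :
    n ≤ 8 := by
  classical
  by_contra hn9
  push Not at hn9
  have h := hP.1
  have hs := hP.2.1
  obtain ⟨V0, hV0⟩ : ∃ V, IsIFace P V 0 := by
    have hne : (P.extremePoints ℝ).Nonempty := by
      apply h.isCompact'.extremePoints_nonempty
      obtain ⟨S, hS, rfl⟩ := h
      exact (Finset.coe_nonempty.2 hS).convexHull
    obtain ⟨v, hv⟩ := hne
    exact ⟨{v}, (vertex_iff hn h hs _).2 ⟨v, hv, rfl⟩⟩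
  have ha0 : 0 < (fF h 0).card := Finset.card_pos.2 ⟨V0, (mem_fF h 0 V0).2 hV0⟩
  have hchoose : 0 < n.choose 2 := Nat.choose_pos (by omega)
  have ha2 : 0 < (fF h 2).card := by
    have := many_faces hn hP hV0
    rw [ncard_fF h] at this
    have h2 := Finset.card_filter_le (fF h 2) (fun f => V0 ⊆ f)
    have h3 := hchoose.trans_le (this.trans h2)
    omega
  -- total vertex count
  have hvn : ∀ f, nFacesIn P f 0 = ((fF h 0).filter (· ⊆ f)).card := fun f => ncard_fF h 0 _
  have hdc : ∀ T : Finset (Set (E n)), ∑ f ∈ T, nFacesIn P f 0 =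
      ∑ V ∈ fF h 0, (T.filter (V ⊆ ·)).card := by
    intro T
    have := Finset.sum_card_bipartiteAbove_eq_sum_card_bipartiteBelow (s := fF h 0) (t := T)
      (fun V f => V ⊆ f)
    simp only [Finset.bipartiteAbove, Finset.bipartiteBelow] at this
    rw [this]
    exact Finset.sum_congr rfl fun f _ => hvn f
  have h1 : (fF h 0).card * n.choose 2 ≤ ∑ f ∈ fF h 2, nFacesIn P f 0 := by
    rw [hdc, ← smul_eq_mul]
    apply Finset.card_nsmul_le_sum
    intro V hV
    have := many_faces hn hP ((mem_fF h 0 V).1 hV)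
    rwa [ncard_fF h] at this
  set Q := (fF h 2).filter (fun f => nFacesIn P f 0 = 4) with hQ
  have h2 : Q.card * 4 ≤ (fF h 0).card * (n + 6) := by
    have e1 : ∑ f ∈ Q, nFacesIn P f 0 = Q.card * 4 := by
      rw [← smul_eq_mul]
      apply Finset.sum_eq_card_nsmul
      intro f hf
      exact (Finset.mem_filter.1 hf).2
    rw [← e1, hdc, ← smul_eq_mul]
    apply Finset.sum_le_card_nsmul
    intro V hV
    have := hquad V ((mem_fF h 0 V).1 hV)
    rw [ncard_fF h] at this
    rw [hQ, Finset.filter_filter]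
    convert this
  have hno3 : ∀ f ∈ fF h 2, nFacesIn P f 0 ≠ 3 := by
    intro f hf hf3
    rw [m2Faces, ncard_fF h, Finset.card_eq_zero] at h3
    have h3' := Finset.eq_empty_iff_forall_notMem.1 h3 f
    exact h3' (Finset.mem_filter.2 ⟨hf, hf3⟩)
  have h4 : (fF h 2).card * 5 ≤ ∑ f ∈ fF h 2, nFacesIn P f 0 + Q.card := by
    rw [hQ, Finset.card_filter, ← Finset.sum_add_distrib, ← smul_eq_mul]
    apply Finset.card_nsmul_le_sum
    intro f hf
    have e1 := three_le hn h hs ((mem_fF h 2 f).1 hf)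
    have e2 := hno3 f hf
    split_ifs <;> omega
  have h5 : ∑ f ∈ fF h 2, nFacesIn P f 0 ≤ ∑ f ∈ fF h 2, nFacesIn P f 1 :=
    Finset.sum_le_sum fun f hf => vert_le_edges hn hP ((mem_fF h 2 f).1 hf)
  have hcoe : facesOf P 2 = (fF h 2 : Set (Set (E n))) := by
    ext F; rw [Finset.mem_coe, mem_fF]; rfl
  have havg : avgFaces P 2 1 = (∑ f ∈ fF h 2, nFacesIn P f 1 : ℕ) / ((fF h 2).card : ℝ) := by
    rw [avgFaces, nFaces, hcoe, ncard_coe_finset, finsum_mem_coe_finset]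
    push_cast
    ring
  rw [havg] at hnik
  have hn9' : (9 : ℝ) ≤ n := by exact_mod_cast hn9
  have hε0 : 0 ≤ ε := by rw [hε]; split_ifs <;> norm_num
  rw [div_lt_div_iff₀ (by exact_mod_cast ha2) (by linarith)] at hnik
  generalize (∑ f ∈ fF h 2, nFacesIn P f 1) = X at *
  generalize (∑ f ∈ fF h 2, nFacesIn P f 0) = Y at *
  generalize (fF h 2).card = a2 at *
  generalize (fF h 0).card = a0 at *
  generalize Q.card = m at *
  have hch : ((n.choose 2 : ℕ) : ℝ) = n * (n - 1) / 2 := Nat.cast_choose_two ℝ n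
  have r1 : (a0 : ℝ) * (n * (n - 1) / 2) ≤ Y := by rw [← hch]; exact_mod_cast h1
  have r2 : (m : ℝ) * 4 ≤ a0 * (n + 6) := by exact_mod_cast h2
  have r4 : (a2 : ℝ) * 5 ≤ Y + m := by exact_mod_cast h4
  have r5 : (Y : ℝ) ≤ X := by exact_mod_cast h5
  have ra2 : (0 : ℝ) < a2 := by exact_mod_cast ha2
  have ra0 : (0 : ℝ) < a0 := by exact_mod_cast ha0
  -- combine
  set N : ℝ := (n : ℝ) with hNdef
  have s1 : (Y : ℝ) * (N - 2 + ε) < 4 * (N - 1 + ε) * a2 :=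
    lt_of_le_of_lt (mul_le_mul_of_nonneg_right r5 (by linarith)) hnik
  have s2 : (m : ℝ) * (2 * (N * (N - 1))) ≤ Y * (N + 6) := by
    have e1 := mul_le_mul_of_nonneg_right r2 (show (0:ℝ) ≤ N * (N - 1) / 2 by nlinarith)
    have e2 := mul_le_mul_of_nonneg_right r1 (show (0:ℝ) ≤ N + 6 by linarith)
    linarith
  have hNN : 0 < N * (N - 1) := by nlinarith
  have s3 : (a2 : ℝ) * (10 * (N * (N - 1))) ≤ Y * (2 * (N * (N - 1)) + N + 6) := by
    have := mul_le_mul_of_nonneg_right r4 (show (0:ℝ) ≤ 2 * (N * (N - 1)) by linarith)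
    linarith
  have hkey : 4 * (N - 1 + ε) * (2 * (N * (N - 1)) + N + 6) ≤
      (N - 2 + ε) * (10 * (N * (N - 1))) := by
    rcases Nat.lt_or_ge n 10 with hlt | hge
    · have : n = 9 := by omega
      have hN : N = 9 := by simp only [N]; rw [this]; norm_num
      have : ε = 1 := by rw [hε, this]; rw [if_neg (by decide)]
      rw [hN, this]; norm_num
    · have hN : 10 ≤ N := by simp only [N]; exact_mod_cast hge
      obtain ⟨k, hk⟩ : ∃ k, N = 10 + k := ⟨N - 10, by ring⟩
      have hk0 : 0 ≤ k := by linarith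
      have : 0 ≤ (N - 2 + ε) * (10 * (N * (N - 1))) -
          4 * (N - 1 + ε) * (2 * (N * (N - 1)) + N + 6) := by
        rw [hk]
        have : (10 + k - 2 + ε) * (10 * ((10 + k) * (10 + k - 1))) -
          4 * (10 + k - 1 + ε) * (2 * ((10 + k) * (10 + k - 1)) + (10 + k) + 6) =
          (144 + 232 * k + 42 * k^2 + 2 * k ^ 3) + ε * (116 + 34 * k + 2 * k^2) := by ring
        rw [this]
        positivity
      linarith
  have hD : 0 < 2 * (N * (N - 1)) + N + 6 := by linarith
  have u1 := mul_lt_mul_of_pos_right s1 hD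
  have u2 := mul_le_mul_of_nonneg_right s3 (show (0:ℝ) ≤ N - 2 + ε by linarith)
  have u3 := mul_le_mul_of_nonneg_left hkey ra2.le
  linarith
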